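/- Let T be a finite tree on at least two vertices that is not a star (i.e., no vertex of T is adjacent to all other vertices) and is not isomorphic to the path graph P_4. Define G_0 = T and G_{j+1} = G_j □ P_2 for j ≥ 0, where P_2 is the path graph on 2 vertices. Then for every j ≥ 0, the eccentricity matrix ℰ(G_j) (over ℝ) has determinant 0, i.e., it is not invertible. -/

import Mathlib

open SimpleGraph

/-- The eccentricity of a vertex `v`: the max distance from `v` to any vertex. -/
noncomputable def ecc {V : Type*} [Fintype V] (G : SimpleGraph V) (v : V) : ℕ :=
  Finset.univ.sup fun u => G.dist v u

/-- `u` is eccentric to `v` in `G` if `d(v,u) = e(v)`. -/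
def IsEccentric {V : Type*} [Fintype V] (G : SimpleGraph V) (v u : V) : Prop :=
  G.dist v u = ecc G v

/-- The eccentric graph of `G`: distinct `u, v` adjacent iff one is eccentric to the other. -/
noncomputable def eccGraph {V : Type*} [Fintype V] (G : SimpleGraph V) : SimpleGraph V :=
  SimpleGraph.fromRel fun u v => IsEccentric G u v

/-- The diameter of `G`: the maximum eccentricity. -/
noncomputable def gdiam {V : Type*} [Fintype V] (G : SimpleGraph V) : ℕ :=
  Finset.univ.sup fun v => ecc G v
/-- The eccentricity matrix of `G` over `ℝ`: the `(u,v)` entry is `d(u,v)` when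
`d(u,v) = min (e u) (e v)`, and `0` otherwise. -/
noncomputable def eccMatrix {V : Type*} [Fintype V] (G : SimpleGraph V) : Matrix V V ℝ :=
  fun u v => if G.dist u v = min (ecc G u) (ecc G v) then (G.dist u v : ℝ) else 0

/-- `G` is a star: some vertex is adjacent to every other vertex. -/
def IsStarGraph {V : Type*} (G : SimpleGraph V) : Prop :=
  ∃ c : V, ∀ v : V, v ≠ c → G.Adj c v

/-- Vertex type of the iterated box product with `P_2`. -/
def iterV (V : Type*) : ℕ → Type _
  | 0 => V
  | j + 1 => iterV V j × Fin 2

instance iterV.fintype (V : Type*) [Fintype V] : ∀ j, Fintype (iterV V j)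
  | 0 => inferInstanceAs (Fintype V)
  | j + 1 => @instFintypeProd _ _ (iterV.fintype V j) inferInstance

instance iterV.decEq (V : Type*) [DecidableEq V] : ∀ j, DecidableEq (iterV V j)
  | 0 => inferInstanceAs (DecidableEq V)
  | j + 1 => @instDecidableEqProd _ _ (iterV.decEq V j) inferInstance

/-- The iterated box product `G_j`, with `G_0 = G` and `G_{j+1} = G_j □ P_2`. -/
noncomputable def iterG {V : Type*} (G : SimpleGraph V) : ∀ j, SimpleGraph (iterV V j)
  | 0 => G
  | j + 1 => (iterG G j).boxProd (pathGraph 2)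

/-- The eccentricity matrix of `G` with every entry selected by the eccentricity condition
increased by `k`. -/
noncomputable def shiftedEccMatrix {V : Type*} [Fintype V] (G : SimpleGraph V) (k : ℕ) :
    Matrix V V ℝ :=
  fun u v => if G.dist u v = min (ecc G u) (ecc G v) then (G.dist u v : ℝ) + k else 0

section Eccentricity

variable {V : Type*} [Fintype V] {G : SimpleGraph V}

lemma shiftedEccMatrix_zero : shiftedEccMatrix G 0 = eccMatrix G := by
  ext u v
  simp [shiftedEccMatrix, eccMatrix]

lemma dist_le_ecc (u v : V) : G.dist u v ≤ ecc G u :=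
  Finset.le_sup (f := fun v => G.dist u v) (Finset.mem_univ v)

lemma ecc_le_iff {u : V} {n : ℕ} : ecc G u ≤ n ↔ ∀ v, G.dist u v ≤ n := by
  simp [ecc]

lemma exists_dist_eq_ecc (u : V) : ∃ v, G.dist u v = ecc G u := by
  obtain ⟨v, -, hv⟩ := Finset.exists_mem_eq_sup Finset.univ ⟨u, Finset.mem_univ u⟩
    (fun v => G.dist u v)
  exact ⟨v, hv.symm⟩

lemma ecc_eq_of_dist_eq {u v : V} {n : ℕ} (h : ∀ w, G.dist u w ≤ n) (hv : G.dist u v = n) :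
    ecc G u = n :=
  le_antisymm (ecc_le_iff.2 h) (hv ▸ dist_le_ecc u v)

end Eccentricity

section BoxProd

lemma dist_pathGraph_two (a b : Fin 2) : (pathGraph 2).dist a b = if a = b then 0 else 1 := by
  rw [pathGraph_two_eq_top, dist_top]

variable {V : Type*} {G : SimpleGraph V}

lemma dist_boxProd_pathGraph_two (hG : G.Connected) (x y : V × Fin 2) :
    (G □ pathGraph 2).dist x y = G.dist x.1 y.1 + if x.2 = y.2 then 0 else 1 := by
  rw [← dist_pathGraph_two, SimpleGraph.dist, edist_boxProd, ENat.toNat_add]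
  · rfl
  · exact edist_ne_top_iff_reachable.2 (hG _ _)
  · exact edist_ne_top_iff_reachable.2 ((pathGraph_connected 1) _ _)

variable [Fintype V]

lemma ecc_boxProd_pathGraph_two (hG : G.Connected) (x : V × Fin 2) :
    ecc (G □ pathGraph 2) x = ecc G x.1 + 1 := by
  obtain ⟨v, hv⟩ := exists_dist_eq_ecc (G := G) x.1
  apply ecc_eq_of_dist_eq (v := (v, x.2 + 1))
  · intro w
    rw [dist_boxProd_pathGraph_two hG]
    have := dist_le_ecc (G := G) x.1 w.1
    split_ifs <;> omega
  · rw [dist_boxProd_pathGraph_two hG, hv]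
    simp

lemma shiftedEccMatrix_boxProd_pathGraph_two (hG : G.Connected) (k : ℕ) (x y : V × Fin 2) :
    shiftedEccMatrix (G □ pathGraph 2) k x y =
      if x.2 = y.2 then 0 else shiftedEccMatrix G (k + 1) x.1 y.1 := by
  have h₁ := dist_le_ecc (G := G) x.1 y.1
  have h₂ := dist_le_ecc (G := G) y.1 x.1
  rw [dist_comm] at h₂
  simp only [shiftedEccMatrix, dist_boxProd_pathGraph_two hG, ecc_boxProd_pathGraph_two hG]
  split_ifs <;> first | omega | rfl | (push_cast; ring)

lemma det_shiftedEccMatrix_boxProd_pathGraph_two [DecidableEq V] (hG : G.Connected) (k : ℕ)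
    (h : (shiftedEccMatrix G (k + 1)).det = 0) :
    (shiftedEccMatrix (G □ pathGraph 2) k).det = 0 := by
  obtain ⟨x, hx, hMx⟩ := Matrix.exists_mulVec_eq_zero_iff.2 h
  refine Matrix.exists_mulVec_eq_zero_iff.1 ⟨fun p => x p.1, ?_, ?_⟩
  · contrapose! hx
    ext v
    exact congrFun hx (v, 0)
  · ext ⟨u, a⟩
    have hu := congrFun hMx u
    simp only [Matrix.mulVec, dotProduct, Pi.zero_apply] at hu ⊢
    simp only [Fintype.sum_prod_type_right, shiftedEccMatrix_boxProd_pathGraph_two hG,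
      Fin.sum_univ_two]
    fin_cases a <;> simp [hu]

end BoxProd

lemma iterG_connected {V : Type*} {G : SimpleGraph V} (hG : G.Connected) (j : ℕ) :
    (iterG G j).Connected := by
  induction j with
  | zero => exact hG
  | succ j ih => exact ih.boxProd (pathGraph_connected 1)

lemma det_shiftedEccMatrix_iterG {V : Type*} [Fintype V] [DecidableEq V] {G : SimpleGraph V}
    (hG : G.Connected) (h : ∀ k, (shiftedEccMatrix G k).det = 0) (j : ℕ) :
    ∀ k, (shiftedEccMatrix (iterG G j) k).det = 0 := by
  induction j with
  | zero => exact h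
  | succ j ih =>
    exact fun k => det_shiftedEccMatrix_boxProd_pathGraph_two (iterG_connected hG j) k (ih (k + 1))

section Tree

variable {V : Type*} {T : SimpleGraph V}

lemma SimpleGraph.notMem_edges_of_length_eq_dist {x y a : V} (p : T.Walk a x)
    (hp : p.length = T.dist a x) (ha : T.dist a x < T.dist a y) : s(x, y) ∉ p.edges := by
  classical
  intro h
  have hy := p.snd_mem_support_of_mem_edges h
  have h₁ := dist_le (p.takeUntil y hy)
  have h₂ := p.length_takeUntil_le_length hy
  omega

/-- The two sides of an edge `xy` of a tree are only connected through that edge. -/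
lemma SimpleGraph.IsTree.dist_eq_of_separated (hT : T.IsTree) {x y a b : V} (hxy : T.Adj x y)
    (ha : T.dist a x < T.dist a y) (hb : T.dist b y < T.dist b x) :
    T.dist a b = T.dist a x + 1 + T.dist b y := by
  classical
  obtain ⟨p, hp⟩ := hT.connected.exists_walk_length_eq_dist a x
  obtain ⟨q, hq⟩ := hT.connected.exists_walk_length_eq_dist b y
  obtain ⟨r, hr⟩ := hT.connected.exists_walk_length_eq_dist a b
  have hbr := isBridge_iff_forall_walk_mem_edges.1
    (isAcyclic_iff_forall_adj_isBridge.1 hT.isAcyclic hxy) (p.reverse.append (r.append q))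
  have hp' := notMem_edges_of_length_eq_dist p hp ha
  have hq' := notMem_edges_of_length_eq_dist q hq hb
  rw [Sym2.eq_swap] at hq'
  simp only [Walk.edges_append, Walk.edges_reverse, List.mem_append, List.mem_reverse, hp', hq',
    false_or, or_false] at hbr
  have hx := r.fst_mem_support_of_mem_edges hbr
  have h₁ := dist_le (r.takeUntil x hx)
  have h₂ := dist_le (r.dropUntil x hx)
  have h₃ := congrArg Walk.length (r.take_spec hx)
  rw [Walk.length_append] at h₃
  have h₄ := hT.connected.dist_triangle (u := a) (v := x) (w := b)
  have h₅ := hT.dist_eq_dist_add_one_of_adj b hxy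
  rw [dist_comm (u := x)] at h₂ h₄
  omega

lemma SimpleGraph.Connected.exists_adj_dist_lt (hT : T.Connected) {c v : V} (h : v ≠ c) :
    ∃ w, T.Adj c w ∧ T.dist v w < T.dist v c := by
  obtain ⟨p, hp⟩ := hT.exists_walk_length_eq_dist c v
  cases p with
  | nil => exact absurd rfl h
  | cons hw p =>
    refine ⟨_, hw, ?_⟩
    have := dist_le p
    rw [Walk.length_cons] at hp
    rw [dist_comm (u := v), dist_comm (u := v)]
    omega

/-- Every vertex lies in at most one branch at a vertex `c` of a tree. -/
lemma SimpleGraph.IsTree.branch_unique (hT : T.IsTree) {c w w' v : V} (hw : T.Adj c w)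
    (hw' : T.Adj c w') (h : T.dist v w < T.dist v c) (h' : T.dist v w' < T.dist v c) :
    w = w' := by
  by_contra hne
  have h₁ : T.dist w' c = 1 := dist_eq_one_iff_adj.2 hw'.symm
  have h₂ := hT.dist_eq_dist_add_one_of_adj w' hw
  have h₃ := hT.connected.pos_dist_of_ne (Ne.symm hne)
  have h₄ := hT.dist_eq_of_separated hw (a := w') (b := v) (by omega) h
  have h₅ := hT.dist_eq_dist_add_one_of_adj v hw
  rw [dist_comm] at h₄
  omega

variable [Fintype V]

/-- A center all of whose branches miss some farthest vertex. -/
lemma det_shiftedEccMatrix_of_center [DecidableEq V] (hT : T.IsTree) (hstar : ¬ IsStarGraph T)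
    (c : V) (hc : ∀ w, T.Adj c w → ∃ v, T.dist c v = ecc T c ∧ T.dist v c < T.dist v w) (k : ℕ) :
    (shiftedEccMatrix T k).det = 0 := by
  classical
  have hρ : 2 ≤ ecc T c := by
    by_contra! h
    refine hstar ⟨c, fun v hv => dist_eq_one_iff_adj.1 ?_⟩
    have := dist_le_ecc (G := T) c v
    have := hT.connected.pos_dist_of_ne hv.symm
    omega
  obtain ⟨z, hz⟩ := exists_dist_eq_ecc (G := T) c
  have hcz : z ≠ c := by
    rintro rfl
    simp at hz
    omega
  obtain ⟨w₀, hw₀, -⟩ := hT.connected.exists_adj_dist_lt hcz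
  have hecc (w : V) (hw : T.Adj c w) : ecc T w = 1 + ecc T c := by
    obtain ⟨v, hv, hvw⟩ := hc w hw
    have h₁ : T.dist w c = 1 := dist_eq_one_iff_adj.2 hw.symm
    apply ecc_eq_of_dist_eq (v := v)
    · intro u
      have := hT.connected.dist_triangle (u := w) (v := c) (w := u)
      have := dist_le_ecc (G := T) c u
      omega
    · have := hT.dist_eq_dist_add_one_of_adj v hw
      rw [dist_comm, ← hv, dist_comm (u := c)]
      omega
  have hlt (v : V) (hvc : v ≠ c) : 1 + ecc T c ≤ ecc T v := by
    obtain ⟨w, hw, hvw⟩ := hT.connected.exists_adj_dist_lt hvc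
    obtain ⟨u, hu, huw⟩ := hc w hw
    have := hT.dist_eq_of_separated hw huw hvw
    have := dist_le_ecc (G := T) v u
    rw [dist_comm] at this hu
    omega
  have hle (v : V) : ecc T c ≤ ecc T v := by
    by_cases hvc : v = c
    · rw [hvc]
    · exact (Nat.le_add_left _ _).trans (hlt v hvc)
  have hrow_c (v : V) : shiftedEccMatrix T k c v =
      if T.dist c v = ecc T c then (ecc T c : ℝ) + k else 0 := by
    rw [shiftedEccMatrix, min_eq_left (hle v)]
    split_ifs with h
    · rw [h]
    · rfl
  have hrow_w (w : V) (hw : T.Adj c w) (v : V) : shiftedEccMatrix T k w v =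
      if T.dist c v = ecc T c ∧ T.dist v c < T.dist v w then 1 + (ecc T c : ℝ) + k else 0 := by
    have h₁ := hT.dist_eq_dist_add_one_of_adj v hw
    have h₂ := dist_le_ecc (G := T) c v
    have h₃ := hle v
    have h₄ : 1 ≤ T.dist v c → 1 + ecc T c ≤ ecc T v := fun h =>
      hlt v fun hvc => by simp [hvc] at h
    have hcv := dist_comm (G := T) (u := c) (v := v)
    have hwv := dist_comm (G := T) (u := w) (v := v)
    rw [shiftedEccMatrix, hecc w hw]
    split_ifs with h h' h'
    · have : T.dist w v = 1 + ecc T c := by omega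
      rw [this]
      push_cast
      ring
    · omega
    · omega
    · rfl
  refine Matrix.exists_vecMul_eq_zero_iff.1
    ⟨fun u => if u = c then -(((T.neighborFinset c).card : ℝ) - 1) / (ecc T c + k)
      else if T.Adj c u then 1 / (1 + ecc T c + k) else 0, ?_, ?_⟩
  · intro h
    have := congrFun h w₀
    simp only [hw₀.ne', hw₀, if_true, if_false, Pi.zero_apply] at this
    have : (0 : ℝ) < 1 / (1 + ecc T c + k) := by positivity
    linarith
  · have hρ0 : (ecc T c : ℝ) + k ≠ 0 := by
      have : (0 : ℝ) < ecc T c := by exact_mod_cast (by omega : 0 < ecc T c)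
      positivity
    have hρ1 : 1 + (ecc T c : ℝ) + k ≠ 0 := by positivity
    ext v
    simp only [Matrix.vecMul, dotProduct, Pi.zero_apply]
    rw [← Finset.add_sum_erase _ _ (Finset.mem_univ c)]
    have hsum : ∑ u ∈ Finset.univ.erase c, (if u = c then
        -(((T.neighborFinset c).card : ℝ) - 1) / (ecc T c + k)
        else if T.Adj c u then 1 / (1 + ecc T c + k) else 0) * shiftedEccMatrix T k u v =
        ∑ w ∈ T.neighborFinset c,
          if T.dist c v = ecc T c ∧ T.dist v c < T.dist v w then (1 : ℝ) else 0 := by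
      symm
      apply Finset.sum_subset_zero_on_sdiff
      · intro w hw
        simpa using ((T.mem_neighborFinset c w).1 hw).ne'
      · intro u hu
        simp only [Finset.mem_sdiff, Finset.mem_erase, mem_neighborFinset] at hu
        simp [hu.1.1, hu.2]
      · intro w hw
        rw [mem_neighborFinset] at hw
        rw [hrow_w w hw, if_neg hw.ne', if_pos hw]
        split_ifs
        · field_simp
        · simp
    rw [hsum, hrow_c]
    by_cases hv : T.dist c v = ecc T c
    · have hvc : v ≠ c := by
        rintro rfl
        simp at hv
        omega
      obtain ⟨w, hw, hvw⟩ := hT.connected.exists_adj_dist_lt hvc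
      have hfil : {u ∈ T.neighborFinset c | T.dist v c < T.dist v u} =
          (T.neighborFinset c).erase w := by
        ext u
        simp only [Finset.mem_filter, Finset.mem_erase, mem_neighborFinset]
        constructor
        · rintro ⟨h₁, h₂⟩
          exact ⟨by rintro rfl; omega, h₁⟩
        · rintro ⟨h₁, h₂⟩
          refine ⟨h₂, ?_⟩
          by_contra! h
          have := hT.dist_ne_of_adj v h₂
          exact h₁ (hT.branch_unique h₂ hw (by omega) hvw)
      have hmem : w ∈ T.neighborFinset c := by simpa using hw
      simp only [hv, true_and, if_true, Finset.sum_boole, hfil,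
        Finset.cast_card_erase_of_mem hmem]
      field_simp
      ring
    · simp [hv]

/-- A central edge: both sides have the same depth `r`. -/
lemma det_shiftedEccMatrix_of_central_edge [DecidableEq V] (hT : T.IsTree)
    (hstar : ¬ IsStarGraph T) (hP4 : ¬ Nonempty (T ≃g pathGraph 4)) {x y a b : V} {r : ℕ}
    (hxy : T.Adj x y) (hx : ∀ u, T.dist u x < T.dist u y → T.dist u x ≤ r)
    (hy : ∀ u, T.dist u y < T.dist u x → T.dist u y ≤ r)
    (ha : T.dist a x < T.dist a y) (har : T.dist a x = r)
    (hb : T.dist b y < T.dist b x) (hbr : T.dist b y = r) (k : ℕ) :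
    (shiftedEccMatrix T k).det = 0 := by
  classical
  have hside (u : V) := hT.dist_eq_dist_add_one_of_adj u hxy
  have hsep {u v : V} (hu : T.dist u x < T.dist u y) (hv : T.dist v y < T.dist v x) :=
    hT.dist_eq_of_separated hxy hu hv
  have hxy1 : T.dist x y = 1 := dist_eq_one_iff_adj.2 hxy
  have hr : 1 ≤ r := by
    by_contra! h
    refine hstar ⟨x, fun v hv => ?_⟩
    have h₁ := hT.connected.pos_dist_of_ne hv
    have h₂ := hx v
    have h₃ := hy v
    have h₄ := hside v
    have : v = y := hT.connected.dist_eq_zero_iff.1 (by omega)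
    exact this ▸ hxy
  have heccx {u : V} (hu : T.dist u x < T.dist u y) : ecc T u = T.dist u x + 1 + r := by
    apply ecc_eq_of_dist_eq (v := b)
    · intro v
      rcases lt_or_gt_of_ne (hT.dist_ne_of_adj v hxy) with hv | hv
      · have := hT.connected.dist_triangle (u := u) (v := x) (w := v)
        have := hx v hv
        rw [dist_comm] at this
        omega
      · have := hsep hu hv
        have := hy v hv
        omega
    · rw [hsep hu hb, hbr]
  have heccy {u : V} (hu : T.dist u y < T.dist u x) : ecc T u = T.dist u y + 1 + r := by
    apply ecc_eq_of_dist_eq (v := a)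
    · intro v
      rcases lt_or_gt_of_ne (hT.dist_ne_of_adj v hxy) with hv | hv
      · have h₁ := hsep hv hu
        have := hx v hv
        rw [dist_comm]
        omega
      · have := hT.connected.dist_triangle (u := u) (v := y) (w := v)
        have := hy v hv
        rw [dist_comm] at this
        omega
    · rw [dist_comm, hsep ha hu, har]
      omega
  set h : V → ℕ := fun u => min (T.dist u x) (T.dist u y) with hh
  have hentry (u v : V) : shiftedEccMatrix T k u v =
      if ((T.dist u x < T.dist u y ↔ T.dist v y < T.dist v x) ∧ (h u = r ∨ h v = r)) then
        (h u : ℝ) + 1 + h v + k else 0 := by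
    have huv := dist_comm (G := T) (u := u) (v := v)
    have hvx := dist_comm (G := T) (u := v) (v := x)
    have hvy := dist_comm (G := T) (u := v) (v := y)
    have t₁ := hT.connected.dist_triangle (u := u) (v := x) (w := v)
    have t₂ := hT.connected.dist_triangle (u := u) (v := y) (w := v)
    have u₁ := hx u
    have u₂ := hy u
    have v₁ := hx v
    have v₂ := hy v
    rw [shiftedEccMatrix]
    rcases lt_or_gt_of_ne (hT.dist_ne_of_adj u hxy) with hu | hu <;>
    rcases lt_or_gt_of_ne (hT.dist_ne_of_adj v hxy) with hv | hv
    · rw [heccx hu, heccx hv, if_neg (by omega), if_neg (by omega)]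
    · have e := hsep hu hv
      have hu' : h u = T.dist u x := by simp only [hh]; omega
      have hv' : h v = T.dist v y := by simp only [hh]; omega
      rw [heccx hu, heccy hv, hu', hv', e]
      split_ifs <;> first | omega | rfl | (push_cast; ring)
    · have e := hsep hv hu
      have hu' : h u = T.dist u y := by simp only [hh]; omega
      have hv' : h v = T.dist v x := by simp only [hh]; omega
      rw [heccy hu, heccx hv, hu', hv', huv, e]
      split_ifs <;> first | omega | rfl | (push_cast; ring)
    · rw [heccy hu, heccy hv, if_neg (by omega), if_neg (by omega)]
  have hcard : 4 < Fintype.card V := by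
    by_contra! hcard
    have hax : a ≠ x := by
      rintro rfl
      simp at har
      omega
    have hby : b ≠ y := by
      rintro rfl
      simp at hbr
      omega
    have hxy' := hxy.ne
    have hay : a ≠ y := by
      rintro rfl
      simp at ha
    have hbx : b ≠ x := by
      rintro rfl
      simp at hb
    have hab : a ≠ b := by
      rintro rfl
      omega
    have hinj : Function.Injective ![a, x, y, b] := by
      intro i j
      fin_cases i <;> fin_cases j <;> simp [*, Ne.symm, hax.symm, hby.symm, hxy'.symm, hay.symm,
        hbx.symm, hab.symm]
    have hcard4 : Fintype.card (Fin 4) = Fintype.card V :=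
      le_antisymm (Fintype.card_le_of_injective _ hinj) (by simpa using hcard)
    have hbij := (Fintype.bijective_iff_injective_and_card _).2 ⟨hinj, hcard4⟩
    have hcases (v : V) : v = a ∨ v = x ∨ v = y ∨ v = b := by
      obtain ⟨i, rfl⟩ := hbij.2 v
      fin_cases i <;> simp
    have dab := hsep ha hb
    have dxb := hsep (u := x) (v := b) (by simp [hxy1]) hb
    simp only [dist_self] at dxb
    have nay : ¬ T.Adj a y := fun h => by
      have := dist_eq_one_iff_adj.2 h
      omega
    have nab : ¬ T.Adj a b := fun h => by
      have := dist_eq_one_iff_adj.2 h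
      omega
    have nxb : ¬ T.Adj x b := fun h => by
      have := dist_eq_one_iff_adj.2 h
      omega
    have adjax : T.Adj a x := by
      obtain ⟨w, hw, -⟩ := hT.connected.exists_adj_dist_lt hax.symm
      rcases hcases w with rfl | rfl | rfl | rfl
      · exact absurd hw (T.irrefl)
      · exact hw
      · exact absurd hw nay
      · exact absurd hw nab
    have adjby : T.Adj y b := by
      obtain ⟨w, hw, -⟩ := hT.connected.exists_adj_dist_lt hby.symm
      rcases hcases w with rfl | rfl | rfl | rfl
      · exact absurd hw.symm nab
      · exact absurd hw.symm nxb
      · exact hw.symm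
      · exact absurd hw (T.irrefl)
    refine hP4 ⟨RelIso.symm ⟨Equiv.ofBijective _ hbij, ?_⟩⟩
    intro i j
    fin_cases i <;> fin_cases j <;>
      simp [pathGraph_adj, hxy, hxy.symm, adjax, adjax.symm, adjby, adjby.symm, nay, nab, nxb,
        mt Adj.symm nay, mt Adj.symm nab, mt Adj.symm nxb]
  obtain ⟨u, v, huv, hclass⟩ := Fintype.exists_ne_map_eq_of_card_lt
    (fun u : V => (decide (T.dist u x < T.dist u y), decide (h u = r))) (by simpa using hcard)
  simp only [Prod.mk.injEq, decide_eq_decide] at hclass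
  obtain ⟨hs, hd⟩ := hclass
  by_cases hur : h u = r
  · refine Matrix.det_zero_of_row_eq huv (funext fun z => ?_)
    have hvr := hd.1 hur
    rw [hentry, hentry, hur, hvr]
    simp only [hs]
  · have hvr := mt hd.2 hur
    refine Matrix.exists_vecMul_eq_zero_iff.1
      ⟨Pi.single u ((h v : ℝ) + 1 + r + k) - Pi.single v ((h u : ℝ) + 1 + r + k), ?_, ?_⟩
    · intro h0
      have := congrFun h0 u
      simp only [Pi.sub_apply, Pi.single_eq_same, Pi.single_eq_of_ne huv, Pi.zero_apply] at this
      have : (0 : ℝ) < (h v : ℝ) + 1 + r + k := by positivity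
      linarith
    · ext z
      rw [Matrix.sub_vecMul]
      simp only [Matrix.single_vecMul, Pi.sub_apply, Pi.smul_apply, Matrix.row, hentry, hur, hvr,
        hs, false_or, smul_eq_mul, Pi.zero_apply]
      split_ifs with hz
      · rw [hz.2]
        ring
      · simp

lemma det_shiftedEccMatrix_tree [DecidableEq V] (hT : T.IsTree) (hstar : ¬ IsStarGraph T)
    (hP4 : ¬ Nonempty (T ≃g pathGraph 4)) (k : ℕ) : (shiftedEccMatrix T k).det = 0 := by
  have := hT.connected.nonempty
  obtain ⟨c, hmin⟩ := Finite.exists_min (ecc T)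
  by_cases hc : ∀ w, T.Adj c w → ∃ v, T.dist c v = ecc T c ∧ T.dist v c < T.dist v w
  · exact det_shiftedEccMatrix_of_center hT hstar c hc k
  push Not at hc
  obtain ⟨w, hw, hfar⟩ := hc
  have hlt {u : V} (hu : T.dist u c < T.dist u w) : T.dist u c < ecc T c := by
    have h₁ := hfar u
    have h₂ := dist_le_ecc (G := T) c u
    rw [dist_comm] at h₁ h₂
    omega
  have hw1 : T.dist c w = 1 := dist_eq_one_iff_adj.2 hw
  obtain ⟨b, hb⟩ := exists_dist_eq_ecc (G := T) c
  have hbw := hfar b hb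
  rw [dist_comm] at hb
  obtain ⟨a, ha⟩ := exists_dist_eq_ecc (G := T) w
  have haw := hmin w
  rw [dist_comm] at ha
  have hside (u : V) := hT.dist_eq_dist_add_one_of_adj u hw
  have hle (u : V) : T.dist u c ≤ ecc T c := by
    rw [dist_comm]
    exact dist_le_ecc c u
  have hla := hle a
  have hsa := hside a
  have hac : T.dist a c < T.dist a w := by omega
  have := hlt hac
  have hsb := hside b
  refine det_shiftedEccMatrix_of_central_edge hT hstar hP4 (r := ecc T c - 1) (a := a) (b := b) hw
    (fun u hu => ?_) (fun u hu => ?_) hac ?_ ?_ ?_ k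
  · have := hlt hu
    omega
  · have := hside u
    have := hle u
    omega
  all_goals omega

end Tree

/-- If `T` is a tree on at least two vertices which is neither a star nor isomorphic to
`P_4`, then the eccentricity matrix of `G_j = T □ P_2 □ ⋯ □ P_2` has determinant 0 for all
`j ≥ 0`. -/
theorem stmt_18 {V : Type*} [Fintype V] [DecidableEq V] (T : SimpleGraph V) (hT : T.IsTree)
    (hcard : 2 ≤ Fintype.card V)
    (hstar : ¬ IsStarGraph T) (hP4 : ¬ Nonempty (T ≃g pathGraph 4)) :
    ∀ j : ℕ, (eccMatrix (iterG T j)).det = 0 := by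
  intro j
  rw [← shiftedEccMatrix_zero]
  exact det_shiftedEccMatrix_iterG hT.connected (det_shiftedEccMatrix_tree hT hstar hP4) j 0
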